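/- Let 1 < p < 2 and β ≥ 0 with βq < 1, where q = p/(p−1). If f ∈ A^1_β(𝕋) and Z(f) has strong α-measure 0, where α = (2/q)(1 − βq), then f is cyclic in A^p_β(𝕋). -/

import Mathlib

open MeasureTheory Real Set Filter Topology ENNReal

noncomputable section

instance : Fact (0 < 2 * Real.pi) := ⟨by positivity⟩

/-- The weighted sum `∑ ‖c n‖^p (1+|n|)^{pβ}` of a Fourier-coefficient sequence,
i.e. `‖c‖_{ℓ^p_β}^p`. -/
def wSum (p β : ℝ) (c : ℤ → ℂ) : ℝ :=
  ∑' n : ℤ, ‖c n‖ ^ p * (1 + |(n : ℝ)|) ^ (p * β)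

/-- Membership in `A^p_β(𝕋)` (equivalently `ℓ^p_β(ℤ)`), expressed via the
Fourier coefficient sequence `c`. -/
def MemA (p β : ℝ) (c : ℤ → ℂ) : Prop :=
  Summable fun n : ℤ => ‖c n‖ ^ p * (1 + |(n : ℝ)|) ^ (p * β)

/-- The `A^p_β(𝕋)` (i.e. `ℓ^p_β(ℤ)`) norm of a Fourier-coefficient sequence. -/
def normA (p β : ℝ) (c : ℤ → ℂ) : ℝ := (wSum p β c) ^ (1 / p)

/-- The function on the circle `𝕋 = ℝ/2πℤ` whose Fourier coefficient sequence is `c`,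
namely `t ↦ ∑_{n ∈ ℤ} c_n e^{int}`. -/
def fSum (c : ℤ → ℂ) (t : AddCircle (2 * Real.pi)) : ℂ :=
  ∑' n : ℤ, c n * fourier n t

/-- The zero set `Z(f)` of the function `f` with Fourier coefficients `c`. -/
def zeroSet (c : ℤ → ℂ) : Set (AddCircle (2 * Real.pi)) := {t | fSum c t = 0}

/-- Convolution of coefficient sequences: the Fourier coefficients of the product
of the corresponding functions/distributions. -/
def convSeq (a c : ℤ → ℂ) (n : ℤ) : ℂ := ∑' k : ℤ, a k * c (n - k)

/-- Cyclicity of (the element with coefficients) `c` in `A^p_β(𝕋)`: there are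
trigonometric polynomials `P` (finitely supported coefficient sequences `a`) with
`‖1 - P·f‖_{A^p_β}` arbitrarily small. -/
def IsCyclicA (p β : ℝ) (c : ℤ → ℂ) : Prop :=
  ∀ ε : ℝ, 0 < ε → ∃ a : ℤ → ℂ, (Function.support a).Finite ∧
    normA p β (fun n => (if n = 0 then 1 else 0) - convSeq a c n) < ε

/-- Fourier coefficient `μ̂(n) = ∫ e^{-int} dμ(t)` of a measure on `ℝ/2πℤ`. -/
def muHat (μ : Measure (AddCircle (2 * Real.pi))) (n : ℤ) : ℂ :=
  ∫ t, fourier (-n) t ∂μ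

/-- The `α`-energy `I_α(μ) = ∑_{n ≥ 1} |μ̂(n)|²/(1+n)^{1-α}` of `μ` is finite. -/
def HasFiniteEnergy (α : ℝ) (μ : Measure (AddCircle (2 * Real.pi))) : Prop :=
  Summable fun n : ℕ => ‖muHat μ (n + 1)‖ ^ 2 / (1 + ((n : ℝ) + 1)) ^ (1 - α)

/-- `C_α(E) = 0`: every probability measure supported on a compact subset of `E`
has infinite `α`-energy. -/
def CapacityZero (α : ℝ) (E : Set (AddCircle (2 * Real.pi))) : Prop :=
  ∀ μ : Measure (AddCircle (2 * Real.pi)), IsProbabilityMeasure μ →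
    (∃ K, K ⊆ E ∧ IsCompact K ∧ μ Kᶜ = 0) → ¬ HasFiniteEnergy α μ

/-- `C_α(E) > 0`: some probability measure supported on a compact subset of `E`
has finite `α`-energy. -/
def CapacityPos (α : ℝ) (E : Set (AddCircle (2 * Real.pi))) : Prop :=
  ∃ μ : Measure (AddCircle (2 * Real.pi)), IsProbabilityMeasure μ ∧
    (∃ K, K ⊆ E ∧ IsCompact K ∧ μ Kᶜ = 0) ∧ HasFiniteEnergy α μ

/-- The `k`-fold Minkowski sum `k × E = E + ⋯ + E`. -/
def kFold (k : ℕ) (E : Set (AddCircle (2 * Real.pi))) : Set (AddCircle (2 * Real.pi)) :=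
  {x | ∃ g : Fin k → AddCircle (2 * Real.pi), (∀ i, g i ∈ E) ∧ x = ∑ i, g i}

/-- Smoothness (`C^∞`) of a function on the circle, via its lift to `ℝ`. -/
def SmoothOnCircle (φ : AddCircle (2 * Real.pi) → ℂ) : Prop :=
  ContDiff ℝ (⊤ : ℕ∞) fun x : ℝ => φ (↑x)

/-- `supp S ⊆ E` for the distribution `S` with Fourier coefficients `s`:
`⟨S, φ⟩ = ∑ₙ Ŝ(n) φ̂(−n) = 0` for every `C^∞` function `φ` supported in `𝕋 ∖ E`. -/
def DistSuppIn (s : ℤ → ℂ) (E : Set (AddCircle (2 * Real.pi))) : Prop :=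
  ∀ φ : AddCircle (2 * Real.pi) → ℂ, SmoothOnCircle φ → tsupport φ ⊆ Eᶜ →
    ∑' n : ℤ, s n * fourierCoeff φ (-n) = 0


/-- The circle. -/
abbrev TT := AddCircle (2 * Real.pi)

/-- The `n`-th Fourier coefficient as a continuous linear functional. -/
def co (n : ℤ) : C(TT, ℂ) →L[ℂ] ℂ :=
  LinearMap.mkContinuous
    { toFun := fun f => fourierCoeff f n
      map_add' := by
        intro f g
        have hf : Integrable (⇑f) (AddCircle.haarAddCircle (T := 2 * Real.pi)) :=
          f.continuous.integrable_of_hasCompactSupport (HasCompactSupport.of_compactSpace _)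
        have hg : Integrable (⇑g) (AddCircle.haarAddCircle (T := 2 * Real.pi)) :=
          g.continuous.integrable_of_hasCompactSupport (HasCompactSupport.of_compactSpace _)
        have := congrFun (fourierCoeff.add hf hg) n
        simpa using this
      map_smul' := by
        intro a f
        have := fourierCoeff.const_smul (⇑f) a n
        simpa using this } 1 (by
    intro f
    simp only [LinearMap.coe_mk, AddHom.coe_mk, one_mul]
    have h := norm_integral_le_of_norm_le_const (μ := AddCircle.haarAddCircle (T := 2 * Real.pi))
      (f := fun t => fourier (-n) t • f t) (C := ‖f‖) (by
        refine ae_of_all _ fun t => ?_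
        rw [norm_smul, fourier_apply, Circle.norm_coe, one_mul]
        exact f.norm_coe_le_norm t)
    simpa [fourierCoeff] using h)

lemma co_apply (n : ℤ) (f : C(TT, ℂ)) : co n f = fourierCoeff f n := rfl

lemma co_fourier (m n : ℤ) : co n (fourier m) = if n = m then 1 else 0 := by
  rw [co_apply, fourierCoeff_fourier, Pi.single_apply]

lemma co_one (n : ℤ) : co n (1 : C(TT, ℂ)) = if n = 0 then 1 else 0 := by
  have : (1 : C(TT, ℂ)) = fourier 0 := by ext t; simp
  rw [this, co_fourier]

lemma co_fourier_mul (m n : ℤ) (g : C(TT, ℂ)) : co n (fourier m * g) = co (n - m) g := by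
  simp only [co_apply, fourierCoeff]
  refine integral_congr_ae (ae_of_all _ fun t => ?_)
  simp only [ContinuousMap.mul_apply, smul_eq_mul]
  rw [← mul_assoc, ← fourier_add]
  congr 3
  ring

lemma hasSum_co {f : C(TT, ℂ)} (h : Summable fun n => co n f) :
    HasSum (fun n => co n f • (fourier n : C(TT, ℂ))) f :=
  hasSum_fourier_series_of_summable h

lemma co_mul {f : C(TT, ℂ)} (h : Summable fun n => co n f) (g : C(TT, ℂ)) (n : ℤ) :
    HasSum (fun m => co m f * co (n - m) g) (co n (f * g)) := by
  have h1 := (hasSum_co h).mul_right g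
  have h2 := (co n).hasSum h1
  convert h2 using 2 with m
  rw [smul_mul_assoc, map_smul, co_fourier_mul, smul_eq_mul]

/-- The continuous function with Fourier coefficients `c`. -/
def fC (c : ℤ → ℂ) : C(TT, ℂ) := ∑' n, c n • (fourier n : C(TT, ℂ))

lemma fC_hasSum {c : ℤ → ℂ} (h : Summable fun n => ‖c n‖) :
    HasSum (fun n => c n • (fourier n : C(TT, ℂ))) (fC c) := by
  refine Summable.hasSum (Summable.of_norm ?_)
  simpa [norm_smul, fourier_norm] using h

lemma co_fC {c : ℤ → ℂ} (h : Summable fun n => ‖c n‖) (n : ℤ) : co n (fC c) = c n := by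
  have h2 := (co n).hasSum (fC_hasSum h)
  simp only [map_smul, co_fourier, smul_eq_mul, mul_ite, mul_one, mul_zero] at h2
  have h3 := hasSum_ite_eq n (c n)
  refine h2.unique ?_
  convert h3 using 2 with m
  by_cases hm : n = m
  · subst hm; simp
  · rw [if_neg hm, if_neg (Ne.symm hm)]

lemma fC_apply {c : ℤ → ℂ} (h : Summable fun n => ‖c n‖) (t : TT) : fC c t = fSum c t := by
  have h2 := (ContinuousMap.evalCLM ℂ t).hasSum (fC_hasSum h)
  have : HasSum (fun n => c n * fourier n t) (fC c t) := h2
  rw [fSum, this.tsum_eq]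

/-- weight -/
def wt (β : ℝ) (n : ℤ) : ℝ := (1 + |(n : ℝ)|) ^ β

lemma one_le_wt {β : ℝ} (hβ : 0 ≤ β) (n : ℤ) : 1 ≤ wt β n :=
  Real.one_le_rpow (by linarith [abs_nonneg (n : ℝ)]) hβ

lemma wt_pos (β : ℝ) (n : ℤ) : 0 < wt β n := by unfold wt; positivity

lemma wt_add {β : ℝ} (hβ : 0 ≤ β) (m n : ℤ) : wt β (m + n) ≤ wt β m * wt β n := by
  unfold wt
  rw [← Real.mul_rpow (by positivity) (by positivity)]
  refine Real.rpow_le_rpow (by positivity) ?_ hβ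
  push_cast
  have := abs_add_le (m : ℝ) n
  nlinarith [mul_nonneg (abs_nonneg (m : ℝ)) (abs_nonneg (n : ℝ))]

/-- `A^1_β` norm -/
def NA (β : ℝ) (f : C(TT, ℂ)) : ℝ≥0∞ := ∑' n, ‖co n f‖ₑ * ENNReal.ofReal (wt β n)

/-- `p`th power of the `A^p_β` norm -/
def NP (p β : ℝ) (f : C(TT, ℂ)) : ℝ≥0∞ := ∑' n, (‖co n f‖ₑ * ENNReal.ofReal (wt β n)) ^ p

lemma NA_add (β : ℝ) (f g : C(TT, ℂ)) : NA β (f + g) ≤ NA β f + NA β g := by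
  unfold NA
  rw [← ENNReal.tsum_add]
  refine ENNReal.tsum_le_tsum fun n => ?_
  rw [map_add, ← add_mul]
  gcongr
  exact enorm_add_le _ _

lemma NP_add {p : ℝ} (hp : 1 ≤ p) (β : ℝ) (f g : C(TT, ℂ)) :
    NP p β (f + g) ≤ 2 ^ (p - 1) * (NP p β f + NP p β g) := by
  unfold NP
  rw [← ENNReal.tsum_add, ← ENNReal.tsum_mul_left]
  refine ENNReal.tsum_le_tsum fun n => ?_
  refine le_trans ?_ (ENNReal.rpow_add_le_mul_rpow_add_rpow _ _ hp)
  rw [map_add, ← add_mul]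
  gcongr
  exact enorm_add_le _ _

lemma NP_le_NA {p : ℝ} (hp : 1 ≤ p) (β : ℝ) (f : C(TT, ℂ)) : NP p β f ≤ NA β f ^ p := by
  have h1 : ∀ x : ℝ≥0∞, x ^ p = x * x ^ (p - 1) := by
    intro x
    have := ENNReal.rpow_add_of_nonneg (x := x) 1 (p - 1) zero_le_one (by linarith)
    rw [ENNReal.rpow_one] at this
    rw [← this]; congr 1; ring
  unfold NP
  rw [h1 (NA β f)]
  calc _ ≤ ∑' n, (‖co n f‖ₑ * ENNReal.ofReal (wt β n)) * NA β f ^ (p - 1) := by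
        refine ENNReal.tsum_le_tsum fun n => ?_
        rw [h1]
        gcongr
        exact ENNReal.le_tsum (f := fun n => ‖co n f‖ₑ * ENNReal.ofReal (wt β n)) n
    _ = _ := by rw [ENNReal.tsum_mul_right]; rfl

lemma summable_of_NA {β : ℝ} (hβ : 0 ≤ β) {f : C(TT, ℂ)} (h : NA β f ≠ ⊤) :
    Summable fun n => co n f := by
  rw [← summable_norm_iff]
  have h2 : ∑' n, ‖co n f‖ₑ ≠ ⊤ := by
    refine ne_top_of_le_ne_top h (ENNReal.tsum_le_tsum fun n => ?_)
    calc ‖co n f‖ₑ = ‖co n f‖ₑ * 1 := by rw [mul_one]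
      _ ≤ _ := by
        gcongr
        simpa using ENNReal.ofReal_le_ofReal (one_le_wt hβ n)
  have := ENNReal.summable_toReal h2
  simpa using this

lemma NA_mul {β : ℝ} (hβ : 0 ≤ β) {f : C(TT, ℂ)} (h : NA β f ≠ ⊤) (g : C(TT, ℂ)) :
    NA β (f * g) ≤ NA β f * NA β g := by
  have hs := summable_of_NA hβ h
  calc NA β (f * g) ≤ ∑' n, ∑' m, (‖co m f‖ₑ * ENNReal.ofReal (wt β m)) *
        (‖co (n - m) g‖ₑ * ENNReal.ofReal (wt β (n - m))) := by
        refine ENNReal.tsum_le_tsum fun n => ?_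
        rw [← (co_mul hs g n).tsum_eq]
        calc _ ≤ (∑' m, ‖co m f * co (n - m) g‖ₑ) * ENNReal.ofReal (wt β n) := by
              gcongr; exact enorm_tsum_le_tsum_enorm
          _ = ∑' m, ‖co m f * co (n - m) g‖ₑ * ENNReal.ofReal (wt β n) :=
              ENNReal.tsum_mul_right.symm
          _ ≤ _ := by
              refine ENNReal.tsum_le_tsum fun m => ?_
              rw [enorm_mul, mul_mul_mul_comm, ← ENNReal.ofReal_mul (wt_pos _ _).le]
              gcongr
              have := wt_add hβ m (n - m)
              simpa using this
    _ = ∑' m, ∑' n, (‖co m f‖ₑ * ENNReal.ofReal (wt β m)) *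
        (‖co (n - m) g‖ₑ * ENNReal.ofReal (wt β (n - m))) := ENNReal.tsum_comm
    _ = ∑' m, (‖co m f‖ₑ * ENNReal.ofReal (wt β m)) * NA β g := by
        congr 1; ext m
        rw [ENNReal.tsum_mul_left]
        congr 1
        exact (Equiv.subRight m).tsum_eq (fun n => ‖co n g‖ₑ * ENNReal.ofReal (wt β n))
    _ = _ := by rw [ENNReal.tsum_mul_right]; rfl

lemma NA_one (β : ℝ) : NA β 1 = 1 := by
  unfold NA
  rw [tsum_eq_single 0]
  · simp [co_one, wt]
  · intro n hn; simp [co_one, hn]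

lemma NA_pow {β : ℝ} (hβ : 0 ≤ β) {f : C(TT, ℂ)} (h : NA β f ≠ ⊤) (k : ℕ) :
    NA β (f ^ k) ≤ NA β f ^ k := by
  induction k with
  | zero => simp [NA_one]
  | succ k ih =>
    rw [pow_succ', pow_succ']
    exact (NA_mul hβ h _).trans (by gcongr)

lemma NA_sum (β : ℝ) {ι : Type*} (s : Finset ι) (f : ι → C(TT, ℂ)) :
    NA β (∑ i ∈ s, f i) ≤ ∑ i ∈ s, NA β (f i) := by
  classical
  induction s using Finset.induction_on with
  | empty => simp [NA]
  | insert a s ha ih =>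
    rw [Finset.sum_insert ha, Finset.sum_insert ha]
    exact (NA_add _ _ _).trans (by gcongr)

/-- truncation -/
def tr (s : Finset ℤ) (f : C(TT, ℂ)) : C(TT, ℂ) := ∑ m ∈ s, co m f • (fourier m : C(TT, ℂ))

lemma co_tr (s : Finset ℤ) (f : C(TT, ℂ)) (n : ℤ) :
    co n (tr s f) = if n ∈ s then co n f else 0 := by
  simp [tr, map_sum, co_fourier]

lemma exists_tr {β : ℝ} {f : C(TT, ℂ)} (h : NA β f ≠ ⊤) {ε : ℝ≥0∞} (hε : 0 < ε) :
    ∃ s, NA β (f - tr s f) < ε := by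
  have h1 := ENNReal.tendsto_tsum_compl_atTop_zero h
  obtain ⟨s, hs⟩ := (h1.eventually (gt_mem_nhds hε)).exists
  refine ⟨s, lt_of_le_of_lt (le_of_eq ?_) hs⟩
  unfold NA
  refine Eq.trans ?_
    (tsum_subtype {b | b ∉ s} (fun n => ‖co n f‖ₑ * ENNReal.ofReal (wt β n))).symm
  congr 1; ext n
  rw [map_sub, co_tr]
  by_cases hn : n ∈ s <;> simp [hn]

lemma NA_tr_ne_top (β : ℝ) (s : Finset ℤ) (f : C(TT, ℂ)) : NA β (tr s f) ≠ ⊤ := by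
  unfold NA
  rw [tsum_eq_sum (s := s)]
  · exact (ENNReal.sum_lt_top.2 fun n _ => ENNReal.mul_lt_top (by simp) (by simp)).ne
  · intro n hn; simp [co_tr, hn]


local notation "hm" => (AddCircle.haarAddCircle (T := 2 * Real.pi))

lemma parseval_le (f : C(TT, ℂ)) {B : ℝ} (hf : ∀ t, ‖f t‖ ≤ B) {G : Set TT}
    (hGm : MeasurableSet G) (hG : ∀ t, t ∉ G → f t = 0) :
    ∑' n, ‖co n f‖ₑ ^ 2 ≤ ENNReal.ofReal (B ^ 2) * hm G := by
  have h1 := hasSum_sq_fourierCoeff (ContinuousMap.toLp (E := ℂ) 2 hm ℂ f)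
  simp_rw [fourierCoeff_toLp] at h1
  have h2 : ∫ t, ‖(ContinuousMap.toLp (E := ℂ) 2 hm ℂ f) t‖ ^ 2 ∂hm = ∫ t, ‖f t‖ ^ 2 ∂hm := by
    refine integral_congr_ae ?_
    filter_upwards [ContinuousMap.coeFn_toLp (p := 2) (𝕜 := ℂ) hm f] with t ht
    rw [ht]
  rw [h2] at h1
  have h3 : ∑' n, ‖co n f‖ₑ ^ 2 = ENNReal.ofReal (∫ t, ‖f t‖ ^ 2 ∂hm) := by
    rw [← h1.tsum_eq, ENNReal.ofReal_tsum_of_nonneg (fun n => by positivity) h1.summable]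
    congr 1; ext n
    rw [ENNReal.ofReal_pow (norm_nonneg _), ofReal_norm]
    rfl
  rw [h3]
  calc ENNReal.ofReal (∫ t, ‖f t‖ ^ 2 ∂hm)
      ≤ ENNReal.ofReal (∫ t, G.indicator (fun _ => B ^ 2) t ∂hm) := by
        refine ENNReal.ofReal_le_ofReal (integral_mono_of_nonneg ?_ ?_ ?_)
        · exact ae_of_all _ fun t => by positivity
        · exact (integrable_const _).indicator hGm
        · refine ae_of_all _ fun t => ?_
          by_cases ht : t ∈ G
          · simp only [ht, indicator_of_mem]
            have := hf t
            gcongr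
          · simp [ht, hG t ht]
    _ = _ := by
        rw [integral_indicator hGm, setIntegral_const, smul_eq_mul, mul_comm,
          ENNReal.ofReal_mul (by positivity)]
        congr 1
        simp [Measure.real]

/-- translation -/
def tl (h : TT) (f : C(TT, ℂ)) : C(TT, ℂ) := ⟨fun t => f (t + h), by fun_prop⟩

lemma co_tl (h : TT) (f : C(TT, ℂ)) (n : ℤ) : co n (tl h f) = fourier n h * co n f := by
  simp only [co_apply, fourierCoeff]
  have := integral_add_right_eq_self (μ := hm) (fun t => fourier (-n) (t - h) • f t) h
  rw [← integral_const_mul]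
  simp only [add_sub_cancel_right] at this
  refine Eq.trans ?_ (this.trans ?_)
  · rfl
  · refine integral_congr_ae (ae_of_all _ fun t => ?_)
    simp only [smul_eq_mul]
    rw [← mul_assoc]
    congr 1
    simp only [fourier_apply]
    rw [← Circle.coe_mul, ← AddCircle.toCircle_add]
    congr 2
    simp only [smul_sub, neg_smul]
    abel

lemma lip_sum (f : C(TT, ℂ)) {L : ℝ} (hL0 : 0 ≤ L) (hL : ∀ x y, ‖f x - f y‖ ≤ L * ‖x - y‖)
    {G : Set TT} (hGm : MeasurableSet G) (hG : ∀ t, t ∉ G → f t = 0) :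
    ∑' n : ℤ, ENNReal.ofReal ((n : ℝ) ^ 2) * ‖co n f‖ₑ ^ 2 ≤ ENNReal.ofReal (8 * L ^ 2) * hm G := by
  rw [ENNReal.tsum_eq_iSup_sum]
  refine iSup_le fun s => ?_
  set K : ℝ := 1 + ∑ n ∈ s, |(n : ℝ)| with hK
  have hK1 : 1 ≤ K := by
    have : 0 ≤ ∑ n ∈ s, |(n : ℝ)| := Finset.sum_nonneg fun _ _ => abs_nonneg _
    linarith
  have hK0 : 0 < K := by linarith
  have hsK : ∀ n ∈ s, |(n : ℝ)| ≤ K := by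
    intro n hn
    have := Finset.single_le_sum (f := fun n : ℤ => |(n : ℝ)|) (fun _ _ => abs_nonneg _) hn
    rw [hK]
    linarith
  set h : TT := ((K⁻¹ : ℝ) : TT) with hh
  have hnh : ‖h‖ ≤ K⁻¹ := by
    have : ‖h‖ = |K⁻¹| := by
      rw [hh, AddCircle.norm_coe_eq_abs_iff _ (by positivity)]
      rw [abs_of_pos (by positivity), abs_of_pos (by positivity)]
      have : K⁻¹ ≤ 1 := inv_le_one_of_one_le₀ hK1
      linarith [Real.pi_gt_three]
    rw [this, abs_of_pos (by positivity)]
  have key : ∀ n ∈ s, (n : ℝ) ^ 2 ≤ 4 * K ^ 2 * ‖(fourier n h : ℂ) - 1‖ ^ 2 := by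
    intro n hn
    have e1 : (fourier n h : ℂ) = Complex.exp (Complex.I * ((n * K⁻¹ : ℝ) : ℂ)) := by
      rw [hh, fourier_coe_apply]
      congr 1
      push_cast
      have : (Real.pi : ℂ) ≠ 0 := by exact_mod_cast Real.pi_ne_zero
      field_simp
    rw [e1, Complex.norm_exp_I_mul_ofReal_sub_one]
    have hx : |(n : ℝ) * K⁻¹| ≤ 1 := by
      rw [abs_mul, abs_of_pos (inv_pos.2 hK0), ← div_eq_mul_inv, div_le_one hK0]
      exact hsK n hn
    have h4 := Real.mul_abs_le_abs_sin (x := (n * K⁻¹) / 2) (by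
      rw [abs_div, abs_two]; linarith [Real.pi_gt_three])
    have h5 : |(n : ℝ) * K⁻¹| ≤ 2 * ‖2 * Real.sin ((n * K⁻¹) / 2)‖ := by
      rw [Real.norm_eq_abs, abs_mul 2, abs_two]
      rw [abs_div, abs_two] at h4
      have h6 : 1 / 2 ≤ 2 / Real.pi := by
        rw [div_le_div_iff₀ (by norm_num) Real.pi_pos]; linarith [Real.pi_le_four]
      nlinarith [abs_nonneg ((n : ℝ) * K⁻¹)]
    have h6 : (n : ℝ) = K * (n * K⁻¹) := by field_simp
    calc (n : ℝ) ^ 2 = K ^ 2 * |(n : ℝ) * K⁻¹| ^ 2 := by rw [sq_abs, ← mul_pow, ← h6]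
      _ ≤ K ^ 2 * (2 * ‖2 * Real.sin ((n * K⁻¹) / 2)‖) ^ 2 := by gcongr
      _ = _ := by ring
  have hP := parseval_le (tl h f - f) (B := L * K⁻¹) (by
      intro t
      simp only [ContinuousMap.sub_apply, tl, ContinuousMap.coe_mk]
      refine (hL _ _).trans ?_
      rw [add_sub_cancel_left]
      gcongr) (G := G ∪ (fun t => t + h) ⁻¹' G)
      (hGm.union (measurable_add_const h hGm)) (by
      intro t ht
      simp only [mem_union, mem_preimage, not_or] at ht
      simp [tl, hG _ ht.1, hG _ ht.2])
  have hmG : hm (G ∪ (fun t => t + h) ⁻¹' G) ≤ 2 * hm G := by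
    refine (measure_union_le _ _).trans ?_
    rw [measure_preimage_add_right]
    exact (two_mul _).ge
  calc ∑ n ∈ s, ENNReal.ofReal ((n : ℝ) ^ 2) * ‖co n f‖ₑ ^ 2
      ≤ ∑ n ∈ s, ENNReal.ofReal (4 * K ^ 2) * ‖co n (tl h f - f)‖ₑ ^ 2 := by
        refine Finset.sum_le_sum fun n hn => ?_
        have : co n (tl h f - f) = (fourier n h - 1) * co n f := by
          rw [map_sub, co_tl]; ring
        rw [this, enorm_mul, mul_pow, ← mul_assoc]
        gcongr
        rw [← ofReal_norm, ← ENNReal.ofReal_pow (norm_nonneg _),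
          ← ENNReal.ofReal_mul (by positivity)]
        exact ENNReal.ofReal_le_ofReal (key n hn)
    _ = ENNReal.ofReal (4 * K ^ 2) * ∑ n ∈ s, ‖co n (tl h f - f)‖ₑ ^ 2 := by rw [Finset.mul_sum]
    _ ≤ ENNReal.ofReal (4 * K ^ 2) * (ENNReal.ofReal ((L * K⁻¹) ^ 2) * (2 * hm G)) := by
        gcongr
        exact (ENNReal.sum_le_tsum s).trans (hP.trans (by gcongr))
    _ = _ := by
        have : (2 : ℝ≥0∞) = ENNReal.ofReal 2 := by simp
        rw [this, ← mul_assoc, ← mul_assoc, ← ENNReal.ofReal_mul (by positivity),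
          ← ENNReal.ofReal_mul (by positivity)]
        congr 2
        field_simp
        ring

lemma tsum_holder {ι : Type*} {p q : ℝ} (hpq : p.HolderConjugate q) (f g : ι → ℝ≥0∞) :
    ∑' i, f i * g i ≤ (∑' i, f i ^ p) ^ (1 / p) * (∑' i, g i ^ q) ^ (1 / q) := by
  let _ : MeasurableSpace ι := ⊤
  have := ENNReal.lintegral_mul_le_Lp_mul_Lq (Measure.count : Measure ι) hpq
    (f := f) (g := g) (measurable_from_top).aemeasurable (measurable_from_top).aemeasurable
  have _ : MeasurableSingletonClass ι := ⟨fun _ => trivial⟩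
  simpa [lintegral_count] using this


lemma summable_japanese {b : ℝ} (hb : 1 < b) : Summable fun j : ℤ => (1 + |(j : ℝ)|) ^ (-b) := by
  refine Summable.of_norm_bounded_eventually (Real.summable_abs_int_rpow hb) ?_
  have : ∀ᶠ j : ℤ in cofinite, j ≠ 0 := by
    simpa using (Set.finite_singleton (0 : ℤ)).eventually_cofinite_notMem
  filter_upwards [this] with j hj
  have hj0 : 0 < |(j : ℝ)| := abs_pos.2 (by exact_mod_cast hj)
  rw [Real.norm_of_nonneg (by positivity)]
  exact Real.rpow_le_rpow_of_nonpos hj0 (by linarith) (by linarith)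

lemma weight_sum {s σ : ℝ} (hs : 0 ≤ s) (hσ0 : 0 ≤ σ) (h : 1 < 2 * σ - s) :
    ∃ C : ℝ, 0 ≤ C ∧ ∀ D : ℕ, 1 ≤ D →
      ∑' n : ℤ, ENNReal.ofReal ((1 + |(n : ℝ)|) ^ s * (1 + (n / D : ℝ) ^ 2) ^ (-σ)) ≤
        ENNReal.ofReal (C * (D : ℝ) ^ (s + 1)) := by
  have hsum := summable_japanese h
  set S := ∑' j : ℤ, (1 + |(j : ℝ)|) ^ (-(2 * σ - s)) with hS
  have hS0 : 0 ≤ S := tsum_nonneg fun j => by positivity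
  refine ⟨8 ^ σ * S, by positivity, fun D hD => ?_⟩
  have : NeZero D := ⟨by omega⟩
  have hD0 : (0 : ℝ) < D := by exact_mod_cast hD
  rw [← (Int.divModEquiv D).symm.tsum_eq, ENNReal.tsum_prod']
  have hterm : ∀ (j : ℤ) (i : Fin D), ENNReal.ofReal
      ((1 + |(((Int.divModEquiv D).symm (j, i) : ℤ) : ℝ)|) ^ s *
        (1 + (((Int.divModEquiv D).symm (j, i) : ℤ) / D : ℝ) ^ 2) ^ (-σ)) ≤
      ENNReal.ofReal (8 ^ σ * (D : ℝ) ^ s * (1 + |(j : ℝ)|) ^ (-(2 * σ - s))) := by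
    intro j i
    refine ENNReal.ofReal_le_ofReal ?_
    rw [Int.divModEquiv_symm_apply]
    have hi : ((i : ℕ) : ℝ) + 1 ≤ D := by exact_mod_cast i.2
    have hi0 : (0 : ℝ) ≤ ((i : ℕ) : ℝ) := by positivity
    simp only
    push_cast
    rw [add_comm ((j : ℝ) * D)]
    set x : ℝ := ((i : ℕ) : ℝ)
    set y : ℝ := (j : ℝ) with hy
    have hj : y ≤ -1 ∨ 0 ≤ y := by
      rcases lt_or_ge j 0 with h | h
      · left; rw [hy]; exact_mod_cast (by omega : j ≤ -1)
      · right; rw [hy]; exact_mod_cast h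
    have h1 : 1 + |x + y * D| ≤ D * (1 + |y|) := by
      rcases hj with h | h
      · rw [abs_of_neg (by linarith : y < 0), abs_of_nonpos (by nlinarith)]
        nlinarith
      · rw [abs_of_nonneg h, abs_of_nonneg (by positivity)]
        nlinarith
    have h2 : (1 + |y|) ^ 2 / 8 ≤ 1 + ((x + y * D) / D) ^ 2 := by
      have e : (x + y * D) / D = x / D + y := by field_simp
      have hx1 : x / D ≤ 1 := by rw [div_le_one hD0]; linarith
      have hx0 : 0 ≤ x / D := by positivity
      rw [e]
      set z := x / D
      have e2 : |y| ≤ 1 + |z + y| := by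
        rcases hj with h | h
        · rw [abs_of_neg (by linarith : y < 0)]
          have := neg_abs_le (z + y)
          linarith
        · rw [abs_of_nonneg h]
          have := le_abs_self (z + y)
          linarith
      have e3 : (1 + |y|) ^ 2 ≤ (2 + |z + y|) ^ 2 := by
        exact pow_le_pow_left₀ (by positivity) (by linarith) 2
      nlinarith [sq_nonneg (2 - |z + y|), sq_abs (z + y)]
    calc _ ≤ (D * (1 + |y|)) ^ s * ((1 + |y|) ^ 2 / 8) ^ (-σ) := by
          refine mul_le_mul (Real.rpow_le_rpow (by positivity) h1 hs) ?_ (by positivity)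
            (by positivity)
          exact Real.rpow_le_rpow_of_nonpos (by positivity) h2 (neg_nonpos.2 hσ0)
      _ = _ := by
          have hy0 : 0 < 1 + |y| := by positivity
          rw [Real.mul_rpow hD0.le hy0.le, Real.div_rpow (by positivity) (by norm_num),
            ← Real.rpow_natCast, ← Real.rpow_mul hy0.le, Real.rpow_neg (by norm_num : (0:ℝ) ≤ 8),
            div_inv_eq_mul]
          have : -(2 * σ - s) = s + ((2 : ℕ) : ℝ) * (-σ) := by push_cast; ring
          rw [this, Real.rpow_add hy0]
          ring
  calc _ ≤ ∑' (j : ℤ) (_ : Fin D),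
        ENNReal.ofReal (8 ^ σ * (D : ℝ) ^ s * (1 + |(j : ℝ)|) ^ (-(2 * σ - s))) :=
        ENNReal.tsum_le_tsum fun j => ENNReal.tsum_le_tsum fun i => hterm j i
    _ = ∑' (j : ℤ), ENNReal.ofReal (D * (8 ^ σ * (D : ℝ) ^ s)) *
        ENNReal.ofReal ((1 + |(j : ℝ)|) ^ (-(2 * σ - s))) := by
        congr 1; ext j
        rw [tsum_fintype, Finset.sum_const, Finset.card_univ, Fintype.card_fin, nsmul_eq_mul,
          ← ENNReal.ofReal_mul (by positivity), ← ENNReal.ofReal_natCast,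
          ← ENNReal.ofReal_mul (by positivity)]
        congr 1; ring
    _ = ENNReal.ofReal (D * (8 ^ σ * (D : ℝ) ^ s)) * ENNReal.ofReal S := by
        rw [ENNReal.tsum_mul_left, hS, ENNReal.ofReal_tsum_of_nonneg (fun j => by positivity) hsum]
    _ = _ := by
        rw [← ENNReal.ofReal_mul (by positivity), Real.rpow_add hD0, Real.rpow_one]
        congr 1; ring
    _ ≤ _ := le_rfl


lemma NP_bound {p β : ℝ} (hp1 : 1 ≤ p) (hp2 : p < 2) (hβ : 0 ≤ β) (h : 2 + 2 * p * β < 3 * p) :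
    ∃ C : ℝ, 0 ≤ C ∧ ∀ (D : ℕ), 1 ≤ D → ∀ (f : C(TT, ℂ)) (B L : ℝ) (G : Set TT),
      0 ≤ L → (∀ t, ‖f t‖ ≤ B) → (∀ x y, ‖f x - f y‖ ≤ L * ‖x - y‖) → MeasurableSet G →
      (∀ t, t ∉ G → f t = 0) →
      NP p β f ≤ (ENNReal.ofReal (B ^ 2 + 8 * (L / D) ^ 2) * hm G) ^ (p / 2) *
        ENNReal.ofReal (C * (D : ℝ) ^ (p * β + 1 - p / 2)) := by
  have h2p : 0 < 2 - p := by linarith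
  obtain ⟨C, hC0, hC⟩ := weight_sum (s := 2 * p * β / (2 - p)) (σ := p / (2 - p))
    (by positivity) (by positivity) (by
      rw [← mul_div_assoc, ← sub_div, lt_div_iff₀ h2p]; linarith)
  refine ⟨C ^ (1 - p / 2), by positivity, fun D hD f B L G hL0 hfB hfL hGm hG => ?_⟩
  have hD0 : (0 : ℝ) < D := by exact_mod_cast hD
  set e : ℤ → ℝ := fun n => 1 + (n / D : ℝ) ^ 2 with he
  have he0 : ∀ n, 0 < e n := fun n => by rw [he]; positivity
  have hconj : (2 / p).HolderConjugate (2 / (2 - p)) := by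
    rw [Real.holderConjugate_iff]
    refine ⟨by rw [lt_div_iff₀ (by linarith)]; linarith, ?_⟩
    field_simp; ring
  have hsum : ∑' n, ‖co n f‖ₑ ^ 2 * ENNReal.ofReal (e n) ≤
      ENNReal.ofReal (B ^ 2 + 8 * (L / D) ^ 2) * hm G := by
    have h1 := parseval_le f hfB hGm hG
    have h2 := lip_sum f hL0 hfL hGm hG
    calc _ = ∑' n, ‖co n f‖ₑ ^ 2 + ENNReal.ofReal ((D : ℝ)⁻¹ ^ 2) *
          ∑' n : ℤ, ENNReal.ofReal ((n : ℝ) ^ 2) * ‖co n f‖ₑ ^ 2 := by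
          rw [← ENNReal.tsum_mul_left, ← ENNReal.tsum_add]
          congr 1; ext n
          rw [he]
          simp only
          rw [ENNReal.ofReal_add zero_le_one (by positivity), mul_add, ENNReal.ofReal_one, mul_one,
            ← mul_assoc, ← ENNReal.ofReal_mul (by positivity), mul_comm (‖co n f‖ₑ ^ 2)]
          congr 3
          field_simp
      _ ≤ ENNReal.ofReal (B ^ 2) * hm G + ENNReal.ofReal ((D : ℝ)⁻¹ ^ 2) *
          (ENNReal.ofReal (8 * L ^ 2) * hm G) := by gcongr
      _ = _ := by
          rw [← mul_assoc, ← ENNReal.ofReal_mul (by positivity), ← add_mul,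
            ← ENNReal.ofReal_add (by positivity) (by positivity)]
          congr 3
          field_simp
  have hterm : ∀ n, (‖co n f‖ₑ * ENNReal.ofReal (wt β n)) ^ p =
      (‖co n f‖ₑ ^ 2 * ENNReal.ofReal (e n)) ^ (p / 2) *
        ENNReal.ofReal (wt β n ^ p * e n ^ (-(p / 2))) := by
    intro n
    have hw := wt_pos β n
    have hen := he0 n
    rw [ENNReal.mul_rpow_of_nonneg _ _ (by linarith : 0 ≤ p),
      ENNReal.mul_rpow_of_nonneg _ _ (by linarith : 0 ≤ p / 2),
      ENNReal.ofReal_rpow_of_pos hw, ENNReal.ofReal_rpow_of_pos hen, mul_assoc,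
      ← ENNReal.ofReal_mul (by positivity), ← ENNReal.rpow_natCast, ← ENNReal.rpow_mul]
    congr 2
    · push_cast; ring
    · rw [Real.rpow_neg hen.le]; field_simp
  unfold NP
  simp_rw [hterm]
  refine (tsum_holder hconj _ _).trans ?_
  refine mul_le_mul' ?_ ?_
  · have : 1 / (2 / p) = p / 2 := by field_simp
    rw [this]
    refine ENNReal.rpow_le_rpow ?_ (by linarith)
    refine le_trans (le_of_eq ?_) hsum
    congr 1; ext n
    rw [← ENNReal.rpow_mul]
    have : p / 2 * (2 / p) = 1 := by field_simp
    rw [this, ENNReal.rpow_one]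
  · have e1 : 1 / (2 / (2 - p)) = 1 - p / 2 := by field_simp
    rw [e1]
    have h1p : 0 ≤ 1 - p / 2 := by linarith
    have : ∑' n, ENNReal.ofReal (wt β n ^ p * e n ^ (-(p / 2))) ^ (2 / (2 - p)) ≤
        ENNReal.ofReal (C * (D : ℝ) ^ (2 * p * β / (2 - p) + 1)) := by
      refine le_trans (le_of_eq ?_) (hC D hD)
      congr 1; ext n
      have hw := wt_pos β n
      have hen := he0 n
      rw [ENNReal.ofReal_rpow_of_pos (by positivity), Real.mul_rpow (by positivity) (by positivity),
        ← Real.rpow_mul hw.le, ← Real.rpow_mul hen.le, wt, ← Real.rpow_mul (by positivity)]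
      congr 3
      · field_simp
      · field_simp
    refine (ENNReal.rpow_le_rpow this h1p).trans (le_of_eq ?_)
    rw [ENNReal.ofReal_rpow_of_nonneg (by positivity) h1p, Real.mul_rpow hC0 (by positivity),
      ← Real.rpow_mul hD0.le]
    congr 3
    field_simp
    ring

lemma NA_eq_NP (β : ℝ) (f : C(TT, ℂ)) : NA β f = NP 1 β f := by
  simp [NA, NP]

lemma NA_bound {β : ℝ} (hβ : 0 ≤ β) (h : β < 1 / 2) :
    ∃ C : ℝ, 0 ≤ C ∧ ∀ (f : C(TT, ℂ)) (B L : ℝ), 0 ≤ B → 0 ≤ L → (∀ t, ‖f t‖ ≤ B) →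
      (∀ x y, ‖f x - f y‖ ≤ L * ‖x - y‖) → NA β f ≤ ENNReal.ofReal (C * (B + L)) := by
  obtain ⟨C, hC0, hC⟩ := NP_bound (p := 1) (β := β) le_rfl (by norm_num) hβ (by linarith)
  refine ⟨3 * C, by positivity, fun f B L hB hL hfB hfL => ?_⟩
  have := hC 1 le_rfl f B L univ hL hfB hfL MeasurableSet.univ (by simp)
  rw [NA_eq_NP]
  refine this.trans ?_
  simp only [Nat.cast_one, Real.one_rpow, mul_one, div_one, measure_univ]
  rw [ENNReal.ofReal_rpow_of_nonneg (by positivity) (by norm_num),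
    ← ENNReal.ofReal_mul (by positivity)]
  refine ENNReal.ofReal_le_ofReal ?_
  rw [← Real.sqrt_eq_rpow]
  have : √(B ^ 2 + 8 * L ^ 2) ≤ 3 * (B + L) := by
    rw [Real.sqrt_le_left (by positivity)]
    nlinarith [mul_nonneg hB hL, sq_nonneg B, sq_nonneg L]
  nlinarith


/-- bounded by one and Lipschitz -/
def BL (f : C(TT, ℂ)) (L : ℝ) : Prop :=
  0 ≤ L ∧ (∀ t, ‖f t‖ ≤ 1) ∧ ∀ x y, ‖f x - f y‖ ≤ L * ‖x - y‖

lemma BL.mul {f g : C(TT, ℂ)} {L M : ℝ} (hf : BL f L) (hg : BL g M) : BL (f * g) (L + M) := by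
  obtain ⟨hL, hf1, hf2⟩ := hf
  obtain ⟨hM, hg1, hg2⟩ := hg
  refine ⟨by positivity, fun t => ?_, fun x y => ?_⟩
  · rw [ContinuousMap.mul_apply, norm_mul]
    exact mul_le_one₀ (hf1 t) (norm_nonneg _) (hg1 t)
  · simp only [ContinuousMap.mul_apply]
    have : f x * g x - f y * g y = (f x - f y) * g x + f y * (g x - g y) := by ring
    rw [this]
    refine (norm_add_le _ _).trans ?_
    rw [norm_mul, norm_mul, add_mul]
    have h1 := hf2 x y
    have h2 := hg2 x y
    have h3 := hg1 x
    have h4 := hf1 y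
    have h5 : ‖f x - f y‖ * ‖g x‖ ≤ ‖f x - f y‖ := mul_le_of_le_one_right (norm_nonneg _) h3
    have h6 : ‖f y‖ * ‖g x - g y‖ ≤ ‖g x - g y‖ := mul_le_of_le_one_left (norm_nonneg _) h4
    linarith

lemma BL.one : BL 1 0 := ⟨le_rfl, by simp, by simp⟩

lemma BL.pow {f : C(TT, ℂ)} {L : ℝ} (hf : BL f L) (k : ℕ) : BL (f ^ k) (k * L) := by
  induction k with
  | zero => simpa using BL.one
  | succ k ih =>
    rw [pow_succ]
    have := ih.mul hf
    convert this using 1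
    push_cast; ring

lemma exists_rep (u : TT) : ∃ r : ℝ, (r : TT) = u ∧ |r| = ‖u‖ := by
  obtain ⟨x, rfl⟩ := QuotientAddGroup.mk_surjective u
  refine ⟨x - round ((2 * Real.pi)⁻¹ * x) * (2 * Real.pi), ?_, ?_⟩
  · rw [AddCircle.coe_sub, ← zsmul_eq_mul, AddCircle.coe_zsmul, AddCircle.coe_period]
    simp
  · exact (AddCircle.norm_eq (p := 2 * Real.pi)).symm

lemma fourier_lip (n : ℤ) (x y : TT) :
    ‖(fourier n x : ℂ) - fourier n y‖ ≤ |(n : ℝ)| * ‖x - y‖ := by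
  obtain ⟨r, hr, hr2⟩ := exists_rep (x - y)
  have h1 : (fourier n x : ℂ) - fourier n y = fourier n y * (fourier n (x - y) - 1) := by
    have : x = y + (x - y) := by abel
    conv_lhs => rw [this]
    simp only [fourier_apply, smul_add, AddCircle.toCircle_add, Circle.coe_mul]
    ring
  rw [h1, norm_mul, fourier_apply, Circle.norm_coe, one_mul, ← hr2, ← hr, fourier_coe_apply]
  have e1 : 2 * (Real.pi : ℂ) * Complex.I * n * r / ((2 * Real.pi : ℝ) : ℂ) =
      Complex.I * ((n * r : ℝ) : ℂ) := by
    push_cast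
    have : (Real.pi : ℂ) ≠ 0 := by exact_mod_cast Real.pi_ne_zero
    field_simp
  rw [e1]
  refine (Real.norm_exp_I_mul_ofReal_sub_one_le).trans ?_
  rw [Real.norm_eq_abs, abs_mul]

lemma tr_lip (s : Finset ℤ) (f : C(TT, ℂ)) :
    ∃ L : ℝ, 0 ≤ L ∧ ∀ x y, ‖tr s f x - tr s f y‖ ≤ L * ‖x - y‖ := by
  refine ⟨∑ n ∈ s, ‖co n f‖ * |(n : ℝ)|, by positivity, fun x y => ?_⟩
  simp only [tr, ContinuousMap.coe_sum, Finset.sum_apply, ContinuousMap.coe_smul, Pi.smul_apply,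
    smul_eq_mul]
  rw [← Finset.sum_sub_distrib, Finset.sum_mul]
  refine (norm_sum_le _ _).trans (Finset.sum_le_sum fun n _ => ?_)
  rw [← mul_sub, norm_mul, mul_assoc]
  exact mul_le_mul_of_nonneg_left (fourier_lip n x y) (norm_nonneg _)

lemma enorm_le_NA {β : ℝ} (hβ : 0 ≤ β) (f : C(TT, ℂ)) (t : TT) : ‖f t‖ₑ ≤ NA β f := by
  by_cases h : NA β f = ⊤
  · simp [h]
  have hs := hasSum_co (summable_of_NA hβ h)
  have h2 : HasSum (fun n => co n f * fourier n t) (f t) := (ContinuousMap.evalCLM ℂ t).hasSum hs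
  rw [← h2.tsum_eq]
  refine enorm_tsum_le_tsum_enorm.trans (ENNReal.tsum_le_tsum fun n => ?_)
  rw [enorm_mul]
  gcongr
  have h1 : ‖(fourier n t : ℂ)‖ₑ = 1 := by
    rw [← ofReal_norm, fourier_apply, Circle.norm_coe, ENNReal.ofReal_one]
  rw [h1]
  simpa using ENNReal.ofReal_le_ofReal (one_le_wt hβ n)

lemma exists_inv {P : C(TT, ℂ)} {Λ m : ℝ} (hΛ : 0 ≤ Λ)
    (hP : ∀ x y, ‖P x - P y‖ ≤ Λ * ‖x - y‖) (hmp : 0 < m) :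
    ∃ (U : C(TT, ℂ)) (M : ℝ), BL U M ∧ ∀ t, m ≤ ‖P t‖ → P t * U t = m := by
  have hmax : ∀ t, 0 < max ‖P t‖ m := fun t => lt_max_of_lt_right hmp
  have hmax' : ∀ t, ((max ‖P t‖ m : ℝ) : ℂ) ≠ 0 := fun t => by exact_mod_cast (hmax t).ne'
  let U1 : C(TT, ℂ) := ⟨fun t => (starRingEnd ℂ) (P t) / ((max ‖P t‖ m : ℝ) : ℂ), by
    refine Continuous.div (by fun_prop) (by fun_prop) hmax'⟩
  let U2 : C(TT, ℂ) := ⟨fun t => (m : ℂ) / ((max ‖P t‖ m : ℝ) : ℂ), by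
    refine Continuous.div (by fun_prop) (by fun_prop) hmax'⟩
  have hd : ∀ x y, |max ‖P y‖ m - max ‖P x‖ m| ≤ Λ * ‖x - y‖ := by
    intro x y
    refine (abs_max_sub_max_le_abs _ _ _).trans ((abs_norm_sub_norm_le _ _).trans ?_)
    rw [norm_sub_rev]
    exact hP x y
  have h1 : BL U1 (2 / m * Λ) := by
    refine ⟨by positivity, fun t => ?_, fun x y => ?_⟩
    · simp only [U1, ContinuousMap.coe_mk, norm_div, RCLike.norm_conj, Complex.norm_real]
      rw [Real.norm_of_nonneg (hmax t).le]
      exact div_le_one_of_le₀ (le_max_left _ _) (hmax t).le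
    · have e : U1 x - U1 y = ((starRingEnd ℂ) (P x - P y) * ((max ‖P y‖ m : ℝ) : ℂ) +
          (starRingEnd ℂ) (P y) * ((max ‖P y‖ m - max ‖P x‖ m : ℝ) : ℂ)) /
          (((max ‖P x‖ m : ℝ) : ℂ) * ((max ‖P y‖ m : ℝ) : ℂ)) := by
        simp only [U1, ContinuousMap.coe_mk]
        rw [div_sub_div _ _ (hmax' x) (hmax' y)]
        congr 1
        rw [map_sub]; push_cast; ring
      rw [e, norm_div, norm_mul, Complex.norm_real, Complex.norm_real,
        Real.norm_of_nonneg (hmax x).le, Real.norm_of_nonneg (hmax y).le,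
        div_le_iff₀ (mul_pos (hmax x) (hmax y))]
      refine (norm_add_le _ _).trans ?_
      rw [norm_mul, norm_mul, RCLike.norm_conj, RCLike.norm_conj, Complex.norm_real,
        Complex.norm_real, Real.norm_of_nonneg (hmax y).le, Real.norm_eq_abs]
      have a1 := hP x y
      have a2 := hd x y
      have a3 : ‖P y‖ ≤ max ‖P y‖ m := le_max_left _ _
      have a4 : m ≤ max ‖P x‖ m := le_max_right _ _
      have hy := hmax y
      set A := max ‖P y‖ m
      set B := max ‖P x‖ m
      set δ := Λ * ‖x - y‖ with hδ
      have hδ0 : 0 ≤ δ := by positivity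
      have a5 : 1 ≤ B / m := by rwa [one_le_div hmp]
      calc _ ≤ δ * A + A * δ := by
            refine add_le_add (mul_le_mul_of_nonneg_right a1 hy.le) ?_
            exact mul_le_mul a3 a2 (abs_nonneg _) hy.le
        _ = 2 * (δ * A) * 1 := by ring
        _ ≤ 2 * (δ * A) * (B / m) := by gcongr
        _ = _ := by rw [hδ]; ring
  have h2 : BL U2 (1 / m * Λ) := by
    refine ⟨by positivity, fun t => ?_, fun x y => ?_⟩
    · simp only [U2, ContinuousMap.coe_mk, norm_div, Complex.norm_real]
      rw [Real.norm_of_nonneg (hmax t).le, Real.norm_of_nonneg hmp.le]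
      exact div_le_one_of_le₀ (le_max_right _ _) (hmax t).le
    · have e : U2 x - U2 y = ((m * (max ‖P y‖ m - max ‖P x‖ m) : ℝ) : ℂ) /
          (((max ‖P x‖ m : ℝ) : ℂ) * ((max ‖P y‖ m : ℝ) : ℂ)) := by
        simp only [U2, ContinuousMap.coe_mk]
        rw [div_sub_div _ _ (hmax' x) (hmax' y)]
        congr 1
        push_cast; ring
      rw [e, norm_div, norm_mul, Complex.norm_real, Complex.norm_real, Complex.norm_real,
        Real.norm_of_nonneg (hmax x).le, Real.norm_of_nonneg (hmax y).le,
        div_le_iff₀ (mul_pos (hmax x) (hmax y)), norm_mul, Real.norm_of_nonneg hmp.le,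
        Real.norm_eq_abs]
      have a2 := hd x y
      have a3 : m ≤ max ‖P y‖ m := le_max_right _ _
      have a4 : m ≤ max ‖P x‖ m := le_max_right _ _
      set A := max ‖P y‖ m
      set B := max ‖P x‖ m
      set δ := Λ * ‖x - y‖ with hδ
      have hδ0 : 0 ≤ δ := by positivity
      calc _ ≤ m * δ := by gcongr
        _ = δ / m * (m * m) := by field_simp
        _ ≤ δ / m * (B * A) := by gcongr
        _ = _ := by rw [hδ]; ring
  refine ⟨U1 * U2, _, h1.mul h2, fun t ht => ?_⟩
  simp only [ContinuousMap.mul_apply, U1, U2, ContinuousMap.coe_mk]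
  rw [max_eq_left ht]
  have hne : ((‖P t‖ : ℝ) : ℂ) ≠ 0 := by
    exact_mod_cast (lt_of_lt_of_le hmp ht).ne'
  have := Complex.mul_conj' (P t)
  field_simp
  rw [this]

lemma division {β : ℝ} (hβ : 0 ≤ β) (hβ2 : β < 1 / 2) {f φ : C(TT, ℂ)} (hf : NA β f ≠ ⊤) {L m : ℝ}
    (hφ : BL φ L) (hmp : 0 < m) (hfφ : ∀ t, φ t ≠ 0 → 2 * m ≤ ‖f t‖) {ε : ℝ≥0∞} (hε : 0 < ε) :
    ∃ g, NA β g ≠ ⊤ ∧ NA β (φ - g * f) < ε := by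
  obtain ⟨C, hC0, hC⟩ := NA_bound hβ hβ2
  have hBL : ∀ {g : C(TT, ℂ)} {M : ℝ}, BL g M → NA β g ≤ ENNReal.ofReal (C * (1 + M)) :=
    fun {g M} hg => hC g 1 M zero_le_one hg.1 hg.2.1 hg.2.2
  obtain ⟨s, hs⟩ := exists_tr hf (ε := ENNReal.ofReal (m / 2)) (by simpa using hmp)
  set P := tr s f with hPdef
  obtain ⟨Λ, hΛ, hP⟩ := tr_lip s f
  have hPm : ∀ t, φ t ≠ 0 → m ≤ ‖P t‖ := by
    intro t ht
    have h1 := (enorm_le_NA hβ (f - P) t).trans hs.le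
    rw [← ofReal_norm, ENNReal.ofReal_le_ofReal_iff (by positivity), ContinuousMap.sub_apply] at h1
    have h2 := hfφ t ht
    have h3 := norm_sub_norm_le (f t) (P t)
    linarith
  obtain ⟨U, M, hU, hUP⟩ := exists_inv hΛ hP hmp
  set R : C(TT, ℂ) := (-(m : ℂ)⁻¹) • (f - P) with hR
  have hmC : (m : ℂ) ≠ 0 := by exact_mod_cast hmp.ne'
  have hsmul : ∀ (a : ℂ) (g : C(TT, ℂ)), NA β (a • g) = ‖a‖ₑ * NA β g := by
    intro a g
    unfold NA
    rw [← ENNReal.tsum_mul_left]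
    congr 1; ext n
    rw [map_smul, smul_eq_mul, enorm_mul, mul_assoc]
  have hNR : NA β R ≤ ENNReal.ofReal (1 / 2) := by
    rw [hR, hsmul, enorm_neg, ← ofReal_norm, norm_inv, Complex.norm_real, Real.norm_of_nonneg hmp.le]
    calc _ ≤ ENNReal.ofReal m⁻¹ * ENNReal.ofReal (m / 2) := by gcongr
      _ = _ := by rw [← ENNReal.ofReal_mul (by positivity)]; congr 1; field_simp
  have hNRt : NA β R ≠ ⊤ := ne_top_of_le_ne_top ENNReal.ofReal_ne_top hNR
  have hNRk : ∀ k : ℕ, NA β (R ^ k) ≤ ENNReal.ofReal ((1 / 2) ^ k) := by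
    intro k
    refine (NA_pow hβ hNRt k).trans ?_
    rw [ENNReal.ofReal_pow (by norm_num)]
    gcongr
  have hid : φ * (1 - R * U) = ((m : ℂ)⁻¹ • (φ * U)) * f := by
    ext t
    simp only [hR, ContinuousMap.mul_apply, ContinuousMap.sub_apply, ContinuousMap.one_apply,
      ContinuousMap.coe_smul, Pi.smul_apply, smul_eq_mul]
    by_cases ht : φ t = 0
    · simp [ht]
    · have := hUP t (hPm t ht)
      rw [← hPdef] at this
      field_simp
      linear_combination (-1 : ℂ) * this
  have hgeo : ∀ K : ℕ, φ - (∑ k ∈ Finset.range K, (m : ℂ)⁻¹ • ((φ * U ^ (k + 1)) * R ^ k)) * f =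
      (φ * U ^ K) * R ^ K := by
    intro K
    have h1 := mul_neg_geom_sum (R * U) K
    have h2 : (∑ k ∈ Finset.range K, (m : ℂ)⁻¹ • ((φ * U ^ (k + 1)) * R ^ k)) * f =
        φ * (1 - R * U) * ∑ k ∈ Finset.range K, (R * U) ^ k := by
      rw [hid, Finset.sum_mul, Finset.mul_sum]
      refine Finset.sum_congr rfl fun k _ => ?_
      simp only [smul_mul_assoc]
      congr 1
      rw [mul_pow]; ring
    rw [h2, mul_assoc, h1, mul_pow]
    ring
  have hlim : Tendsto (fun K : ℕ => ENNReal.ofReal (C * (1 + (L + K * M)) * (1 / 2) ^ K)) atTop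
      (𝓝 0) := by
    have h1 : Tendsto (fun K : ℕ => (C * (1 + L)) * (1 / 2 : ℝ) ^ K +
        (C * M) * (K * (1 / 2 : ℝ) ^ K)) atTop (𝓝 0) := by
      have a1 := (tendsto_pow_atTop_nhds_zero_of_lt_one (r := (1 / 2 : ℝ)) (by norm_num)
        (by norm_num)).const_mul (C * (1 + L))
      have a2 := (tendsto_self_mul_const_pow_of_lt_one (r := (1 / 2 : ℝ)) (by norm_num)
        (by norm_num)).const_mul (C * M)
      simpa using a1.add a2
    have h2 := ENNReal.tendsto_ofReal h1
    rw [ENNReal.ofReal_zero] at h2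
    refine h2.congr fun K => ?_
    congr 1; ring
  obtain ⟨K, hK⟩ := (hlim.eventually (gt_mem_nhds hε)).exists
  have hfin : ∀ k : ℕ, NA β (φ * U ^ k) ≠ ⊤ := fun k =>
    ne_top_of_le_ne_top ENNReal.ofReal_ne_top (hBL (hφ.mul (hU.pow k)))
  refine ⟨_, ?_, (le_of_eq (congrArg (NA β) (hgeo K))).trans_lt (lt_of_le_of_lt ?_ hK)⟩
  · refine ne_top_of_le_ne_top ?_ (NA_sum β _ _)
    refine (ENNReal.sum_lt_top.2 fun k _ => ?_).ne
    rw [hsmul]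
    refine ENNReal.mul_lt_top (by simp) ?_
    exact (NA_mul hβ (hfin _) _).trans_lt (ENNReal.mul_lt_top (hfin _).lt_top
      ((hNRk k).trans_lt ENNReal.ofReal_lt_top))
  · refine (NA_mul hβ (hfin K) _).trans ?_
    have hM := hU.1
    have hL := hφ.1
    rw [ENNReal.ofReal_mul (by positivity)]
    exact mul_le_mul' (hBL (hφ.mul (hU.pow K))) (hNRk K)



lemma arc_far {E : Set TT} {a b δ : ℝ}
    (hE : ((fun x : ℝ => (x : TT)) '' Set.Ioo a b) ⊆ Eᶜ) {x : ℝ} (hx : x ∈ Ioo (a + δ) (b - δ))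
    {y : TT} (hy : y ∈ E) : δ ≤ dist (x : TT) y := by
  by_contra hlt
  push Not at hlt
  obtain ⟨r, hr, hr2⟩ := exists_rep (y - x)
  rw [dist_comm, dist_eq_norm, ← hr2, abs_lt] at hlt
  refine hE ⟨x + r, ⟨by linarith [hx.1], by linarith [hx.2]⟩, ?_⟩ hy
  simp only [AddCircle.coe_add, hr]
  abel

lemma arc_measure {a b : ℝ} (hab : b - a ≤ 2 * Real.pi) :
    (b - a) / (2 * Real.pi) ≤ (hm).real ((fun x : ℝ => (x : TT)) '' Set.Ioo a b) := by
  have hopen : IsOpen ((fun x : ℝ => (x : TT)) '' Set.Ioo a b) :=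
    QuotientAddGroup.isOpenMap_coe _ isOpen_Ioo
  have h1 := (AddCircle.measurePreserving_mk (2 * Real.pi) a).measure_preimage
    hopen.measurableSet.nullMeasurableSet
  have h2 : ENNReal.ofReal (b - a) ≤
      (volume : Measure TT) ((fun x : ℝ => (x : TT)) '' Set.Ioo a b) := by
    rw [← h1, Measure.restrict_apply' measurableSet_Ioc, ← Real.volume_Ioo]
    refine measure_mono fun x hx => ⟨⟨x, hx, rfl⟩, hx.1, ?_⟩
    linarith [hx.2]
  rw [AddCircle.volume_eq_smul_haarAddCircle, Measure.smul_apply, smul_eq_mul] at h2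
  have h3 : b - a ≤ 2 * Real.pi * (hm).real ((fun x : ℝ => (x : TT)) '' Set.Ioo a b) := by
    rw [← ENNReal.ofReal_le_ofReal_iff (by positivity), ENNReal.ofReal_mul (by positivity)]
    simpa [Measure.real] using h2
  rw [div_le_iff₀ (by positivity)]
  linarith

lemma thick_measure {E : Set TT} (hEne : E.Nonempty) (a b : ℕ → ℝ)
    (hlen : ∀ k, b k - a k ≤ 2 * Real.pi)
    (hdisj : ∀ k l, k ≠ l →
      Disjoint ((fun x : ℝ => (↑x : TT)) '' Set.Ioo (a k) (b k))
               ((fun x : ℝ => (↑x : TT)) '' Set.Ioo (a l) (b l)))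
    (hunion : (⋃ k : ℕ, (fun x : ℝ => (↑x : TT)) '' Set.Ioo (a k) (b k)) = Eᶜ)
    {δ : ℝ} (hδ : 0 ≤ δ) (n : ℕ) :
    (hm).real {t | Metric.infDist t E < δ} ≤
      (2 * Real.pi - ∑ k ∈ Finset.range (n + 1), (b k - a k)) + 2 * δ * (n + 1) := by
  set G := {t : TT | Metric.infDist t E < δ} with hG
  have hGo : IsOpen G := isOpen_lt (Metric.continuous_infDist_pt E) continuous_const
  set I : ℕ → Set TT := fun k => (fun x : ℝ => (↑x : TT)) '' Set.Ioo (a k + δ) (b k - δ) with hI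
  have hIm : ∀ k, MeasurableSet (I k) := fun k =>
    (QuotientAddGroup.isOpenMap_coe _ isOpen_Ioo : IsOpen (I k)).measurableSet
  have hIsub : ∀ k, I k ⊆ (fun x : ℝ => (↑x : TT)) '' Set.Ioo (a k) (b k) := fun k =>
    image_mono (Ioo_subset_Ioo (by linarith) (by linarith))
  have hIG : (⋃ k ∈ Finset.range (n + 1), I k) ⊆ Gᶜ := by
    intro t ht
    simp only [mem_iUnion] at ht
    obtain ⟨k, _, x, hx, rfl⟩ := ht
    simp only [hG, mem_compl_iff, mem_ofPred_eq, not_lt]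
    refine (Metric.le_infDist hEne).2 fun y hy => arc_far ?_ hx hy
    rw [← hunion]
    exact subset_iUnion (fun k => (fun x : ℝ => (↑x : TT)) '' Set.Ioo (a k) (b k)) k
  have h1 : ∑ k ∈ Finset.range (n + 1), (hm).real (I k) ≤ (hm).real Gᶜ := by
    rw [← measureReal_biUnion_finset ?_ fun k _ => hIm k]
    · exact measureReal_mono hIG
    · intro k _ l _ hkl
      exact (hdisj k l hkl).mono (hIsub k) (hIsub l)
  have h2 : ∑ k ∈ Finset.range (n + 1), ((b k - a k) - 2 * δ) / (2 * Real.pi) ≤ (hm).real Gᶜ := by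
    refine le_trans (Finset.sum_le_sum fun k _ => ?_) h1
    have := arc_measure (a := a k + δ) (b := b k - δ) (by linarith [hlen k])
    have e : b k - a k - 2 * δ = (b k - δ) - (a k + δ) := by ring
    rw [e]
    exact this
  rw [probReal_compl_eq_one_sub hGo.measurableSet, ← Finset.sum_div, Finset.sum_sub_distrib,
    Finset.sum_const, Finset.card_range, nsmul_eq_mul, div_le_iff₀ (by positivity)] at h2
  push_cast at h2
  have h3 : 0 ≤ (hm).real G := measureReal_nonneg
  nlinarith [Real.pi_gt_three]

lemma choose_params {α : ℝ} (hα0 : 0 < α) (hα1 : α < 1) (r : ℕ → ℝ)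
    (hr : Tendsto (fun n : ℕ => r n * (n : ℝ) ^ (1 / α - 1)) atTop (𝓝 0)) {η : ℝ} (hη : 0 < η) :
    ∃ (n D : ℕ) (g : ℝ), 1 ≤ D ∧ 0 ≤ g ∧ r n + 2 * (2 / D) * (n + 1) ≤ g ∧
      g * (D : ℝ) ^ (1 - α) < η := by
  obtain ⟨κ, hκ0, hκ1, hκ⟩ : ∃ κ : ℝ, 0 < κ ∧ κ ≤ 1 ∧ 20 * κ ^ α < η := by
    have h1 : Tendsto (fun κ : ℝ => 20 * κ ^ α) (𝓝[>] 0) (𝓝 0) := by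
      have := ((Real.continuous_rpow_const hα0.le).tendsto 0).const_mul 20
      rw [Real.zero_rpow hα0.ne', mul_zero] at this
      exact this.mono_left nhdsWithin_le_nhds
    have h2 : ∀ᶠ κ : ℝ in 𝓝[>] 0, κ ≤ 1 :=
      nhdsWithin_le_nhds (Iic_mem_nhds (by norm_num : (0:ℝ) < 1))
    obtain ⟨κ, hk1, hk2, hk3⟩ := ((h1.eventually (gt_mem_nhds hη)).and
      (h2.and self_mem_nhdsWithin)).exists
    exact ⟨κ, hk3, hk2, hk1⟩
  obtain ⟨n, hn1, hn2⟩ := ((hr.eventually (gt_mem_nhds hκ0)).and (eventually_ge_atTop 1)).exists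
  have hn0 : (1 : ℝ) ≤ n := by exact_mod_cast hn2
  have hnp : (0 : ℝ) < n := by linarith
  have he : 0 < 1 / α - 1 := by
    rw [sub_pos, lt_div_iff₀ hα0]; linarith
  set ρ : ℝ := κ * (n : ℝ) ^ (-(1 / α - 1)) with hρ
  have hρ0 : 0 < ρ := by positivity
  have hρ1 : ρ ≤ 1 := by
    have : (n : ℝ) ^ (-(1 / α - 1)) ≤ 1 := Real.rpow_le_one_of_one_le_of_nonpos hn0 (by linarith)
    exact mul_le_one₀ hκ1 (by positivity) this
  have hrρ : r n ≤ ρ := by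
    rw [hρ, Real.rpow_neg hnp.le, ← div_eq_mul_inv, le_div_iff₀ (by positivity)]
    exact hn1.le
  set D := ⌈((n : ℝ) + 1) / ρ⌉₊ with hD
  have hD1 : ((n : ℝ) + 1) / ρ ≤ D := Nat.le_ceil _
  have hD2 : (D : ℝ) < ((n : ℝ) + 1) / ρ + 1 := Nat.ceil_lt_add_one (by positivity)
  have hq0 : 0 < ((n : ℝ) + 1) / ρ := by positivity
  have hDp : (0 : ℝ) < D := by linarith
  have hD3 : (D : ℝ) ≤ 4 * (n / ρ) := by
    have h1 : ((n : ℝ) + 1) / ρ ≤ 2 * (n / ρ) := by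
      rw [← mul_div_assoc]; gcongr; linarith
    have h2 : 1 ≤ n / ρ := by rw [one_le_div hρ0]; linarith
    linarith
  refine ⟨n, D, 5 * ρ, by exact_mod_cast hDp, by positivity, ?_, ?_⟩
  · rw [div_le_iff₀ hρ0] at hD1
    have : 2 * (2 / (D : ℝ)) * (n + 1) ≤ 4 * ρ := by
      have e : 2 * (2 / (D : ℝ)) * (n + 1) = 4 * (n + 1) / D := by ring
      rw [e, div_le_iff₀ hDp]
      linarith
    linarith
  · refine lt_of_le_of_lt ?_ hκ
    calc 5 * ρ * (D : ℝ) ^ (1 - α) ≤ 5 * ρ * (4 * (n / ρ)) ^ (1 - α) := by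
          have : 0 ≤ 1 - α := by linarith
          gcongr
      _ = 5 * 4 ^ (1 - α) * (ρ ^ α * (n : ℝ) ^ (1 - α)) := by
          rw [Real.mul_rpow (by norm_num) (by positivity), Real.div_rpow hnp.le hρ0.le]
          have : ρ ^ α = ρ / ρ ^ (1 - α) := by
            rw [_root_.eq_div_iff (by positivity), ← Real.rpow_add hρ0]; simp
          rw [this]; ring
      _ = 5 * 4 ^ (1 - α) * κ ^ α := by
          congr 1
          rw [hρ, Real.mul_rpow hκ0.le (by positivity), ← Real.rpow_mul hnp.le, mul_assoc,
            ← Real.rpow_add hnp]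
          have : -(1 / α - 1) * α + (1 - α) = 0 := by field_simp; ring
          rw [this, Real.rpow_zero, mul_one]
      _ ≤ 5 * 4 * κ ^ α := by
          have : (4 : ℝ) ^ (1 - α) ≤ 4 ^ (1 : ℝ) :=
            Real.rpow_le_rpow_of_exponent_le (by norm_num) (by linarith)
          rw [Real.rpow_one] at this
          gcongr
      _ = _ := by ring

/-- The cut-off equal to `1` near `E`. -/
def cut (E : Set TT) (D : ℕ) : C(TT, ℂ) :=
  ⟨fun t => ((max 0 (min 1 (2 - D * Metric.infDist t E)) : ℝ) : ℂ), by
    have := Metric.continuous_infDist_pt E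
    fun_prop⟩

lemma cut_diff (E : Set TT) (D : ℕ) (x y : TT) :
    ‖cut E D x - cut E D y‖ ≤ D * ‖x - y‖ := by
  simp only [cut, ContinuousMap.coe_mk]
  rw [← Complex.ofReal_sub, Complex.norm_real, Real.norm_eq_abs]
  have h1 : |max 0 (min 1 (2 - D * Metric.infDist x E)) -
      max 0 (min 1 (2 - D * Metric.infDist y E))| ≤
      |(2 - D * Metric.infDist x E) - (2 - D * Metric.infDist y E)| := by
    rw [max_comm, max_comm 0, min_comm, min_comm 1]
    exact (abs_max_sub_max_le_abs _ _ _).trans (abs_min_sub_min_le_max _ _ _ _ |>.trans (by simp))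
  refine h1.trans ?_
  have h2 : |Metric.infDist x E - Metric.infDist y E| ≤ ‖x - y‖ := by
    have := (Metric.lipschitz_infDist_pt E).dist_le_mul x y
    rw [Real.dist_eq, dist_eq_norm] at this
    simpa using this
  have e : (2 - D * Metric.infDist x E) - (2 - D * Metric.infDist y E) =
      -(D * (Metric.infDist x E - Metric.infDist y E)) := by ring
  rw [e, abs_neg, abs_mul, abs_of_nonneg (by positivity : (0:ℝ) ≤ D)]
  gcongr

lemma cut_bounds (E : Set TT) (D : ℕ) (t : TT) :
    ∃ v : ℝ, 0 ≤ v ∧ v ≤ 1 ∧ cut E D t = v :=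
  ⟨_, le_max_left _ _, max_le zero_le_one (min_le_left _ _), rfl⟩

lemma exists_cutoff (p q β α : ℝ) (hp1 : 1 < p) (hp2 : p < 2) (hβ : 0 ≤ β)
    (hq : q = p / (p - 1)) (hβq : β * q < 1) (hα : α = (2 / q) * (1 - β * q))
    (f : C(TT, ℂ))
    (a b : ℕ → ℝ)
    (hlen : ∀ k, b k - a k ≤ 2 * Real.pi)
    (hdisj : ∀ k l, k ≠ l →
      Disjoint ((fun x : ℝ => (↑x : TT)) '' Set.Ioo (a k) (b k))
               ((fun x : ℝ => (↑x : TT)) '' Set.Ioo (a l) (b l)))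
    (hunion : (⋃ k : ℕ, (fun x : ℝ => (↑x : TT)) '' Set.Ioo (a k) (b k)) = {t | f t = 0}ᶜ)
    (hstrong : Tendsto
      (fun n : ℕ => (2 * Real.pi - ∑ k ∈ Finset.range (n + 1), (b k - a k)) * (n : ℝ) ^ (1 / α - 1))
      atTop (nhds 0)) {θ : ℝ} (hθ : 0 < θ) :
    ∃ (φ : C(TT, ℂ)) (L m : ℝ), BL φ L ∧ 0 < m ∧ (∀ t, φ t ≠ 0 → 2 * m ≤ ‖f t‖) ∧
      NP p β (1 - φ) < ENNReal.ofReal θ := by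
  have hq0 : 0 < q := by rw [hq]; exact div_pos (by linarith) (by linarith)
  have hα' : α = 2 - 2 / p - 2 * β := by
    rw [hα, hq]
    have : p - 1 ≠ 0 := by linarith
    field_simp
  have hα0 : 0 < α := by rw [hα]; exact mul_pos (by positivity) (by linarith)
  have hα1 : α < 1 := by
    have : 1 < 2 / p := by rw [lt_div_iff₀ (by linarith)]; linarith
    rw [hα']; linarith
  have hmin : ∀ K : Set TT, IsClosed K → (∀ t ∈ K, f t ≠ 0) → ∃ m : ℝ, 0 < m ∧
      ∀ t ∈ K, 2 * m ≤ ‖f t‖ := by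
    intro K hK hf
    obtain ⟨m, hm0, hmK⟩ := hK.isCompact.exists_forall_le' (f := fun t => ‖f t‖)
      (by fun_prop) (a := 0) (fun t ht => norm_pos_iff.2 (hf t ht))
    exact ⟨m / 2, by positivity, fun t ht => by linarith [hmK t ht]⟩
  set E : Set TT := {t | f t = 0} with hE
  have hEc : IsClosed E := isClosed_eq f.continuous continuous_const
  rcases E.eq_empty_or_nonempty with hem | hne
  · obtain ⟨m, hm0, hmK⟩ := hmin univ isClosed_univ (by
      intro t _ ht
      have : t ∈ E := ht
      rw [hem] at this
      exact this)
    refine ⟨1, 0, m, BL.one, hm0, fun t _ => hmK t trivial, ?_⟩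
    have : NP p β (1 - 1) = 0 := by
      have : 0 < p := by linarith
      simp [NP, this]
    rw [this]
    simpa using hθ
  · obtain ⟨C, hC0, hC⟩ := NP_bound (p := p) (β := β) hp1.le hp2 hβ (by
      have h1 : p * α = 2 * p - 2 - 2 * p * β := by rw [hα']; field_simp
      nlinarith [mul_pos (by linarith : 0 < p) hα0])
    obtain ⟨η, hη0, hη⟩ : ∃ η : ℝ, 0 < η ∧ (9 * η) ^ (p / 2) * C < θ := by
      have h1 : Tendsto (fun η : ℝ => (9 * η) ^ (p / 2) * C) (𝓝[>] 0) (𝓝 0) := by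
        have hc : Continuous fun η : ℝ => (9 * η) ^ (p / 2) * C :=
          ((continuous_const.mul continuous_id).rpow_const
            (fun _ => Or.inr (by linarith))).mul continuous_const
        have := hc.tendsto 0
        rw [mul_zero, Real.zero_rpow (by linarith), zero_mul] at this
        exact this.mono_left nhdsWithin_le_nhds
      obtain ⟨η, h2, h3⟩ := ((h1.eventually (gt_mem_nhds hθ)).and self_mem_nhdsWithin).exists
      exact ⟨η, h3, h2⟩
    obtain ⟨n, D, g, hD, hg0, hg, hgD⟩ := choose_params hα0 hα1 _ hstrong hη0
    have hD0 : (0 : ℝ) < D := by exact_mod_cast hD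
    set G : Set TT := {t | Metric.infDist t E < 2 / D} with hG
    have hGo : IsOpen G := isOpen_lt (Metric.continuous_infDist_pt E) continuous_const
    have hGm : hm G ≤ ENNReal.ofReal g := by
      have h1 := thick_measure hne a b hlen hdisj hunion (δ := 2 / D) (by positivity) n
      rw [← ENNReal.ofReal_toReal (measure_ne_top hm G)]
      exact ENNReal.ofReal_le_ofReal (h1.trans hg)
    obtain ⟨m, hm0, hmK⟩ := hmin {t | 1 / (D : ℝ) ≤ Metric.infDist t E}
      (isClosed_le continuous_const (Metric.continuous_infDist_pt E)) (by
        intro t ht hft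
        have : t ∈ E := hft
        have h0 := Metric.infDist_zero_of_mem this
        simp only [mem_ofPred_eq, h0] at ht
        have : 0 < 1 / (D : ℝ) := by positivity
        linarith)
    refine ⟨1 - cut E D, D, m, ⟨hD0.le, fun t => ?_, fun x y => ?_⟩, hm0, fun t ht => ?_, ?_⟩
    · obtain ⟨v, hv0, hv1, hv⟩ := cut_bounds E D t
      rw [ContinuousMap.sub_apply, ContinuousMap.one_apply, hv, ← Complex.ofReal_one,
        ← Complex.ofReal_sub, Complex.norm_real, Real.norm_of_nonneg (by linarith)]
      linarith
    · simp only [ContinuousMap.sub_apply, ContinuousMap.one_apply]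
      rw [_root_.sub_sub_sub_cancel_left, norm_sub_rev]
      exact cut_diff E D x y
    · refine hmK t ?_
      by_contra hcon
      simp only [mem_ofPred_eq, not_le] at hcon
      rw [lt_div_iff₀ hD0] at hcon
      refine ht ?_
      simp only [ContinuousMap.sub_apply, ContinuousMap.one_apply, cut, ContinuousMap.coe_mk]
      rw [min_eq_left (by linarith), max_eq_right zero_le_one]
      simp
    · rw [_root_.sub_sub_cancel]
      have h1 := hC D hD (cut E D) 1 D G hD0.le (fun t => by
        obtain ⟨v, hv0, hv1, hv⟩ := cut_bounds E D t
        rwa [hv, Complex.norm_real, Real.norm_of_nonneg hv0]) (cut_diff E D)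
        hGo.measurableSet (fun t ht => by
          simp only [hG, mem_ofPred_eq, not_lt] at ht
          rw [div_le_iff₀ hD0] at ht
          simp only [cut, ContinuousMap.coe_mk]
          rw [max_eq_left ((min_le_right _ _).trans (by linarith))]
          simp)
      refine h1.trans_lt ?_
      have e9 : (1 : ℝ) ^ 2 + 8 * (D / D : ℝ) ^ 2 = 9 := by
        rw [div_self hD0.ne']; norm_num
      rw [e9]
      calc _ ≤ (ENNReal.ofReal 9 * ENNReal.ofReal g) ^ (p / 2) *
            ENNReal.ofReal (C * (D : ℝ) ^ (p * β + 1 - p / 2)) := by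
            gcongr
        _ = ENNReal.ofReal ((9 * (g * (D : ℝ) ^ (1 - α))) ^ (p / 2) * C) := by
            rw [← ENNReal.ofReal_mul (by norm_num),
              ENNReal.ofReal_rpow_of_nonneg (by positivity) (by linarith),
              ← ENNReal.ofReal_mul (by positivity)]
            congr 1
            rw [← mul_assoc 9, Real.mul_rpow (x := 9 * g) (by positivity) (by positivity),
              ← Real.rpow_mul hD0.le]
            have : (1 - α) * (p / 2) = p * β + 1 - p / 2 := by
              rw [hα']; field_simp; ring
            rw [this]; ring
        _ ≤ ENNReal.ofReal ((9 * η) ^ (p / 2) * C) := by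
            refine ENNReal.ofReal_le_ofReal ?_
            gcongr
        _ < _ := (ENNReal.ofReal_lt_ofReal_iff hθ).2 hη

lemma normA_lt {p β ε : ℝ} (hp : 0 < p) (hε : 0 < ε) {u : C(TT, ℂ)} {x : ℤ → ℂ}
    (hx : ∀ n, x n = co n u) (h : NP p β u < ENNReal.ofReal (ε ^ p)) : normA p β x < ε := by
  have h1 : wSum p β x = (NP p β u).toReal := by
    unfold wSum NP
    rw [ENNReal.tsum_toReal_eq]
    · congr 1; ext n
      rw [← ENNReal.toReal_rpow, ENNReal.toReal_mul, ENNReal.toReal_ofReal (wt_pos β n).le,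
        toReal_enorm, Real.mul_rpow (norm_nonneg _) (wt_pos β n).le, hx, wt,
        ← Real.rpow_mul (by positivity), mul_comm β]
    · intro n
      exact ENNReal.rpow_ne_top_of_nonneg hp.le (ENNReal.mul_ne_top (by simp) (by simp))
  have h2 : (NP p β u).toReal < ε ^ p := by
    have := (ENNReal.toReal_lt_toReal h.ne_top ENNReal.ofReal_ne_top).2 h
    rwa [ENNReal.toReal_ofReal (by positivity)] at this
  unfold normA
  rw [h1]
  calc _ < (ε ^ p) ^ (1 / p) := Real.rpow_lt_rpow ENNReal.toReal_nonneg h2 (by positivity)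
    _ = ε := by rw [← Real.rpow_mul hε.le, mul_one_div_cancel hp.ne', Real.rpow_one]


/-- Theorem B(1): let `1 < p < 2`, `β ≥ 0`, `βq < 1` where
`q = p/(p-1)`, and `α = (2/q)(1-βq)`. Let `f ∈ A^1_β(𝕋)` and suppose the
complementary arcs of `Z(f)` are given by the images in `𝕋 = ℝ/2πℤ` of the
intervals `(a k, b k)` (pairwise disjoint, arranged with non-increasing
lengths, union equal to `𝕋 ∖ Z(f)`). If `Z(f)` has strong `α`-measure `0`,
i.e. `r_n n^{1/α - 1} → 0` where `r_n = 2π - ∑_{k=0}^n (b k - a k)`, then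
`f` is cyclic in `A^p_β(𝕋)`. -/
theorem stmt4 (p q β α : ℝ) (hp1 : 1 < p) (hp2 : p < 2) (hβ : 0 ≤ β)
    (hq : q = p / (p - 1)) (hβq : β * q < 1) (hα : α = (2 / q) * (1 - β * q))
    (c : ℤ → ℂ) (hc : MemA 1 β c)
    (a b : ℕ → ℝ)
    (hab : ∀ k, a k ≤ b k)
    (hlen : ∀ k, b k - a k ≤ 2 * Real.pi)
    (hmono : ∀ k, b (k + 1) - a (k + 1) ≤ b k - a k)
    (hdisj : ∀ k l, k ≠ l →
      Disjoint ((fun x : ℝ => (↑x : AddCircle (2 * Real.pi))) '' Set.Ioo (a k) (b k))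
               ((fun x : ℝ => (↑x : AddCircle (2 * Real.pi))) '' Set.Ioo (a l) (b l)))
    (hunion : (⋃ k : ℕ, (fun x : ℝ => (↑x : AddCircle (2 * Real.pi))) '' Set.Ioo (a k) (b k))
      = (zeroSet c)ᶜ)
    (hstrong : Tendsto
      (fun n : ℕ => (2 * Real.pi - ∑ k ∈ Finset.range (n + 1), (b k - a k)) * (n : ℝ) ^ (1 / α - 1))
      atTop (nhds 0)) :
    IsCyclicA p β c := by
  have hsum : Summable fun n => ‖c n‖ := by
    refine Summable.of_nonneg_of_le (fun n => norm_nonneg _) (fun n => ?_) hc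
    rw [Real.rpow_one, one_mul]
    exact le_mul_of_one_le_right (norm_nonneg _) (one_le_wt hβ n)
  have hco := co_fC hsum
  have hzs : zeroSet c = {t | fC c t = 0} := by
    ext t; simp only [zeroSet, mem_ofPred_eq, fC_apply hsum]
  have hfin : NA β (fC c) ≠ ⊤ := by
    have h1 : NA β (fC c) = ENNReal.ofReal
        (∑' n : ℤ, ‖c n‖ ^ (1 : ℝ) * (1 + |(n : ℝ)|) ^ (1 * β)) := by
      rw [ENNReal.ofReal_tsum_of_nonneg (fun n => by positivity) hc]
      unfold NA
      congr 1; ext n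
      rw [hco, Real.rpow_one, one_mul, ENNReal.ofReal_mul (norm_nonneg _), ofReal_norm, wt]
    rw [h1]; exact ENNReal.ofReal_ne_top
  have hβ2 : β < 1 / 2 := by
    have hq2 : 2 < q := by rw [hq, lt_div_iff₀ (by linarith)]; linarith
    nlinarith
  intro ε hε
  have hεp : 0 < ε ^ p := by positivity
  set θ : ℝ := min 1 (ε ^ p / 8) with hθ
  have hθ0 : 0 < θ := by positivity
  rw [hzs] at hunion
  obtain ⟨φ, L, m, hφ, hm0, hφm, hNP⟩ := exists_cutoff p q β α hp1 hp2 hβ hq hβq hα (fC c) a b hlen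
    hdisj hunion hstrong hθ0
  obtain ⟨g, hg, hgφ⟩ := division hβ hβ2 hfin hφ hm0 hφm (ε := ENNReal.ofReal (θ / 2))
    (by simpa using hθ0)
  obtain ⟨s, hs⟩ := exists_tr hg (ε := ENNReal.ofReal (θ / 2) / NA β (fC c))
    (ENNReal.div_pos (by simpa using hθ0) hfin)
  have hA : NA β (φ - tr s g * fC c) ≤ ENNReal.ofReal θ := by
    have e : φ - tr s g * fC c = (φ - g * fC c) + (g - tr s g) * fC c := by ring
    rw [e]
    refine (NA_add _ _ _).trans ?_
    have h2 : NA β ((g - tr s g) * fC c) ≤ ENNReal.ofReal (θ / 2) := by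
      refine (NA_mul hβ hs.ne_top _).trans ?_
      calc _ ≤ ENNReal.ofReal (θ / 2) / NA β (fC c) * NA β (fC c) := by gcongr
        _ ≤ _ := by rw [mul_comm]; exact ENNReal.mul_div_le
    calc _ ≤ ENNReal.ofReal (θ / 2) + ENNReal.ofReal (θ / 2) := add_le_add hgφ.le h2
      _ = _ := by rw [← ENNReal.ofReal_add (by positivity) (by positivity)]; congr 1; ring
  have hP2 : NP p β (φ - tr s g * fC c) ≤ ENNReal.ofReal θ := by
    refine (NP_le_NA hp1.le β _).trans ?_
    calc _ ≤ ENNReal.ofReal θ ^ p := by gcongr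
      _ = ENNReal.ofReal (θ ^ p) := ENNReal.ofReal_rpow_of_pos hθ0
      _ ≤ ENNReal.ofReal θ := by
        refine ENNReal.ofReal_le_ofReal ?_
        have := Real.rpow_le_rpow_of_exponent_ge hθ0 (min_le_left _ _) hp1.le
        rwa [Real.rpow_one] at this
  refine ⟨fun n => co n (tr s g), ?_, ?_⟩
  · refine s.finite_toSet.subset fun n hn => ?_
    by_contra hns
    exact hn (by simp only [co_tr]; exact if_neg hns)
  · refine normA_lt (by linarith) hε (u := 1 - tr s g * fC c) (fun n => ?_) ?_
    · rw [map_sub, co_one]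
      congr 1
      rw [← (co_mul (summable_of_NA hβ (NA_tr_ne_top β s g)) (fC c) n).tsum_eq]
      unfold convSeq
      simp only [hco]
    · have e : 1 - tr s g * fC c = (1 - φ) + (φ - tr s g * fC c) := by ring
      rw [e]
      refine (NP_add hp1.le β _ _).trans_lt ?_
      have h2 : (2 : ℝ≥0∞) ^ (p - 1) ≤ ENNReal.ofReal 2 := by
        calc (2 : ℝ≥0∞) ^ (p - 1) ≤ 2 ^ (1 : ℝ) :=
              ENNReal.rpow_le_rpow_of_exponent_le (by norm_num) (by linarith)
          _ = _ := by simp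
      calc _ ≤ ENNReal.ofReal 2 * (ENNReal.ofReal θ + ENNReal.ofReal θ) :=
            mul_le_mul' h2 (add_le_add hNP.le hP2)
        _ = ENNReal.ofReal (4 * θ) := by
            rw [← ENNReal.ofReal_add hθ0.le hθ0.le, ← ENNReal.ofReal_mul (by norm_num)]
            congr 1; ring
        _ < ENNReal.ofReal (ε ^ p) := by
            refine (ENNReal.ofReal_lt_ofReal_iff hεp).2 ?_
            have : θ ≤ ε ^ p / 8 := min_le_right _ _
            linarith

end
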